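/- Fix a prime number p and a real number λ ∈ (1,p]. Then the zero-temperature limit of the partition function equals the vacuum degeneracy: lim_{β → ∞} Z_p(λ,β) = 2⌈λ − 1⌉. -/

import Mathlib

/-- `a p lam k = ⌈lam * p^k - 1⌉`, the number of positive integers in `(0, lam·p^k)`. -/
noncomputable def a (p : ℕ) (lam : ℝ) (k : ℤ) : ℤ := ⌈lam * (p : ℝ) ^ k - 1⌉

/-- The partition function `Z_p(λ,β) = 2 Σ_{k≥0} (a_k(λ) − a_{k−1}(λ)) p^{−kβ}`. -/
noncomputable def Z (p : ℕ) (lam β : ℝ) : ℝ :=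
  2 * ∑' k : ℕ, ((a p lam (k : ℤ) - a p lam ((k : ℤ) - 1) : ℤ) : ℝ) * (p : ℝ) ^ (-(k : ℝ) * β)

theorem a_nonneg {p : ℕ} (hp : 0 < p) {lam : ℝ} (h : 0 < lam) (k : ℤ) : 0 ≤ a p lam k := by
  have hp' : (0 : ℝ) < p := by exact_mod_cast hp
  have hpos : 0 < lam * (p : ℝ) ^ k := by positivity
  have : -1 < ⌈lam * (p : ℝ) ^ k - 1⌉ := by
    rw [Int.lt_ceil]
    push_cast
    linarith
  unfold a
  lia

theorem a_le (p : ℕ) (lam : ℝ) (k : ℤ) : (a p lam k : ℝ) ≤ lam * (p : ℝ) ^ k := by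
  have := Int.ceil_lt_add_one (lam * (p : ℝ) ^ k - 1)
  unfold a
  linarith

theorem a_neg_one {p : ℕ} (hp : 0 < p) {lam : ℝ} (h : 0 < lam) (h2 : lam ≤ p) :
    a p lam (-1) = 0 := by
  refine le_antisymm ?_ (a_nonneg hp h _)
  have hp' : (0 : ℝ) < p := by exact_mod_cast hp
  have : lam * (p : ℝ)⁻¹ ≤ 1 := by
    rw [← div_eq_mul_inv]
    exact (div_le_one hp').2 h2
  rw [a, Int.ceil_le, zpow_neg_one]
  push_cast
  linarith

theorem abs_a_sub_a_le {p : ℕ} (hp : 1 ≤ p) {lam : ℝ} (h : 0 < lam) (k : ℕ) :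
    |((a p lam (k : ℤ) - a p lam ((k : ℤ) - 1) : ℤ) : ℝ)| ≤ lam * (p : ℝ) ^ k := by
  have hp' : (1 : ℝ) ≤ p := by exact_mod_cast hp
  have hk := a_le p lam k
  have hk' := a_le p lam ((k : ℤ) - 1)
  have hmono : lam * (p : ℝ) ^ ((k : ℤ) - 1) ≤ lam * (p : ℝ) ^ (k : ℤ) :=
    mul_le_mul_of_nonneg_left (zpow_le_zpow_right₀ hp' (by lia)) h.le
  have h0 : (0 : ℝ) ≤ a p lam k := by exact_mod_cast a_nonneg hp h _
  have h0' : (0 : ℝ) ≤ a p lam ((k : ℤ) - 1) := by exact_mod_cast a_nonneg hp h _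
  rw [zpow_natCast] at hk hmono
  push_cast
  rw [abs_le]
  constructor <;> linarith

/-- For a prime `p` and `λ ∈ (1,p]`, the zero-temperature limit of the partition function
equals the vacuum degeneracy: `lim_{β→∞} Z_p(λ,β) = 2⌈λ−1⌉`. -/
theorem Z_tendsto_vacuum_degeneracy
    (p : ℕ) (hp : p.Prime) (lam : ℝ) (h1 : 1 < lam) (h2 : lam ≤ p) :
    Filter.Tendsto (fun β => Z p lam β) Filter.atTop
      (nhds (2 * ((⌈lam - 1⌉ : ℤ) : ℝ))) := by
  have hlam : 0 < lam := by linarith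
  have hp1 : (1 : ℝ) < p := by exact_mod_cast hp.one_lt
  have hp0 : (0 : ℝ) < p := by linarith
  have hsum : ∑' k : ℕ, (if k = 0 then ((⌈lam - 1⌉ : ℤ) : ℝ) else 0) = ((⌈lam - 1⌉ : ℤ) : ℝ) :=
    tsum_ite_eq 0 _
  unfold Z
  refine Filter.Tendsto.const_mul 2 ?_
  rw [← hsum]
  refine tendsto_tsum_of_dominated_convergence (bound := fun k : ℕ => lam * ((p : ℝ)⁻¹) ^ k)
    ((summable_geometric_of_lt_one (by positivity) (inv_lt_one_of_one_lt₀ hp1)).mul_left lam)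
    (fun k => ?_) ?_
  · rcases Nat.eq_zero_or_pos k with rfl | hk
    · have h := a_neg_one hp.pos hlam h2
      have h0 : a p lam 0 = ⌈lam - 1⌉ := by rw [a, zpow_zero, mul_one]
      simp only [Nat.cast_zero, zero_sub, h, h0, sub_zero, neg_zero, zero_mul, Real.rpow_zero,
        mul_one, if_true]
      exact tendsto_const_nhds
    · rw [if_neg hk.ne', ← mul_zero ((a p lam (k : ℤ) - a p lam ((k : ℤ) - 1) : ℤ) : ℝ)]
      refine Filter.Tendsto.const_mul _ ?_
      have hk' : (0 : ℝ) < k := by exact_mod_cast hk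
      refine (tendsto_rpow_atBot_of_base_gt_one (p : ℝ) hp1).comp ?_
      exact Filter.tendsto_id.const_mul_atTop_of_neg (neg_lt_zero.2 hk')
  · filter_upwards [Filter.eventually_ge_atTop (2 : ℝ)] with β hβ k
    rw [norm_mul, Real.norm_eq_abs, Real.norm_of_nonneg (by positivity)]
    have hpow : (p : ℝ) ^ (-(k : ℝ) * β) ≤ ((p : ℝ) ^ k)⁻¹ * ((p : ℝ) ^ k)⁻¹ := by
      calc (p : ℝ) ^ (-(k : ℝ) * β) ≤ (p : ℝ) ^ (-(k : ℝ) + -(k : ℝ)) := by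
            apply Real.rpow_le_rpow_of_exponent_le hp1.le
            nlinarith [(Nat.cast_nonneg k : (0 : ℝ) ≤ k)]
        _ = _ := by rw [Real.rpow_add hp0, Real.rpow_neg hp0.le, Real.rpow_natCast]
    calc _ ≤ (lam * (p : ℝ) ^ k) * (((p : ℝ) ^ k)⁻¹ * ((p : ℝ) ^ k)⁻¹) :=
          mul_le_mul (abs_a_sub_a_le hp.one_le hlam k) hpow (by positivity) (by positivity)
      _ = lam * ((p : ℝ)⁻¹) ^ k := by
          rw [inv_pow]
          field_simp
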